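/- Let f : ℝⁿ → ℝ be continuously differentiable, let x ∈ ℝⁿ, let p̄ be a unit vector, let v > 0 be such that f is convex along the segment [x, x + v·p̄], let t > 0, and suppose u = x + w·p̄ with w = −t·⟨∇f(u), p̄⟩ and w ∈ [0, v]. Then f(u) ≤ f(x) − t·⟨∇f(u), p̄⟩², and equivalently f(u) ≤ f(x) + w·⟨∇f(u), p̄⟩. -/

import Mathlib

open scoped RealInnerProductSpace

/-- The derivative of a function along a line is the inner product of its gradient with the
direction of the line. -/
theorem DifferentiableAt.hasDerivAt_comp_add_smul {E : Type*} [NormedAddCommGroup E]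
    [InnerProductSpace ℝ E] [CompleteSpace E] {f : E → ℝ} {x p : E} {w : ℝ}
    (hf : DifferentiableAt ℝ f (x + w • p)) :
    HasDerivAt (fun s : ℝ => f (x + s • p)) ⟪gradient f (x + w • p), p⟫ w := by
  have hline : HasDerivAt (fun s : ℝ => x + s • p) p w := by
    simpa using ((hasDerivAt_id w).smul_const p).const_add x
  simpa [Function.comp_def] using
    hf.hasGradientAt.hasFDerivAt.comp_hasDerivAt w hline

/-- the DPPM update is a descent step (Lemma 4 of the paper). -/
theorem dppm_descent {n : ℕ} (f : EuclideanSpace ℝ (Fin n) → ℝ)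
    (hf : ContDiff ℝ 1 f) (x : EuclideanSpace ℝ (Fin n))
    (p : EuclideanSpace ℝ (Fin n)) (hp : ‖p‖ = 1)
    (v : ℝ) (hv : 0 < v)
    (hconv : ConvexOn ℝ (Set.Icc (0:ℝ) v) (fun w : ℝ => f (x + w • p)))
    (t : ℝ) (ht : 0 < t)
    (u : EuclideanSpace ℝ (Fin n)) (w : ℝ)
    (hu : u = x + w • p)
    (hw : w = -t * ⟪gradient f u, p⟫)
    (hwmem : w ∈ Set.Icc (0:ℝ) v) :
    f u ≤ f x - t * ⟪gradient f u, p⟫ ^ 2 ∧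
    f u ≤ f x + w * ⟪gradient f u, p⟫ := by
  have hdescent : f u ≤ f x + w * ⟪gradient f u, p⟫ := by
    subst hu
    have hderiv := (hf.differentiable one_ne_zero (x + w • p)).hasDerivAt_comp_add_smul
    rcases hwmem.1.eq_or_lt with rfl | hpos
    · simp
    · have hslope := hconv.slope_le_of_hasDerivAt
        (Set.left_mem_Icc.2 hv.le) hwmem hpos hderiv
      rw [slope_def_field, sub_zero, div_le_iff₀ hpos, zero_smul, add_zero] at hslope
      linarith
  refine ⟨?_, hdescent⟩
  calc f u ≤ f x + w * ⟪gradient f u, p⟫ := hdescent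
    _ = f x - t * ⟪gradient f u, p⟫ ^ 2 := by rw [hw]; ring
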